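/- arXiv:math/0409609 — 2 statements merged into one kernel-verified Lean document; each statement's English description precedes it below -/
import Mathlib

section
/- A filter F on a set X belongs to ker(F_1^{△△}) — that is, for every set Y and every A ⊆ X × Y the image filter AF belongs to F_1^{△△}(Y) — if and only if F is a principal filter. -/
open Filter Set

universe u

/-- Two filters mesh if all their members intersect, i.e. the filter generated by
pairwise intersections (which is `F ⊓ G` in Mathlib's order) is proper. -/
def Mesh {Z : Type u} (F G : Filter Z) : Prop := Filter.NeBot (F ⊓ G)

/-- The `△` relation: `F △ H` iff whenever `H` meshes `F` there is a proper countably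
based filter refining `F ∨ H` (i.e. `≤ F ⊓ H` in Mathlib's order). -/
def Triangle {Z : Type u} (F H : Filter Z) : Prop :=
  Mesh H F → ∃ L : Filter Z, L.NeBot ∧ L.IsCountablyGenerated ∧ L ≤ F ⊓ H

/-- Fréchet filters: `F △ A` for every subset `A`. -/
def Frechet {Z : Type u} (F : Filter Z) : Prop := ∀ A : Set Z, Triangle F (𝓟 A)

/-- The image filter `AF` of a filter `F` on `X` under a set `A ⊆ X × Y`:
generated by the sets `A(F) = {y | ∃ x ∈ F, (x, y) ∈ A}`. -/
def imgSet {X Y : Type u} (A : Set (X × Y)) (F : Filter X) : Filter Y :=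
  ⨅ f ∈ F, 𝓟 {y | ∃ x ∈ f, (x, y) ∈ A}

theorem Triangle.symm {Z : Type u} {F H : Filter Z} (h : Triangle F H) : Triangle H F := by
  unfold Triangle Mesh at *
  rwa [inf_comm H F] at *

theorem imgSet_principal {X Y : Type u} (A : Set (X × Y)) (S : Set X) :
    imgSet A (𝓟 S) = 𝓟 {y | ∃ x ∈ S, (x, y) ∈ A} := by
  apply le_antisymm
  · exact iInf₂_le S (mem_principal_self S)
  · refine le_iInf₂ fun f hf => principal_mono.2 ?_
    rintro y ⟨x, hx, hxy⟩
    exact ⟨x, hf hx, hxy⟩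

/-- The fan filter on `X × ℕ`: a set belongs to it iff it contains a tail of each column. -/
def fanFilter (X : Type u) : Filter (X × ℕ) := ⨆ x : X, map (Prod.mk x) atTop

theorem mem_fanFilter {X : Type u} {S : Set (X × ℕ)} :
    S ∈ fanFilter X ↔ ∀ x, ∀ᶠ k in atTop, (x, k) ∈ S := by
  simp only [fanFilter, mem_iSup, mem_map]
  rfl

theorem frechet_fanFilter (X : Type u) : Frechet (fanFilter X) := by
  intro A hA
  have h : (⨆ x : X, map (Prod.mk x) (atTop : Filter ℕ) ⊓ 𝓟 A).NeBot := by
    rw [iSup_inf_principal, inf_comm]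
    exact hA
  obtain ⟨x, hx⟩ := iSup_neBot.1 h
  exact ⟨_, hx, inferInstance,
    inf_le_inf_right _ (le_iSup (fun x : X => map (Prod.mk x) (atTop : Filter ℕ)) x)⟩

/-- A countably generated proper filter finer than the fan filter cannot avoid every column. -/
theorem exists_column_compl_notMem {X : Type u} {L : Filter (X × ℕ)} [L.NeBot]
    [L.IsCountablyGenerated] (hL : L ≤ fanFilter X) : ∃ x : X, {p | p.1 ≠ x} ∉ L := by
  by_contra! h
  obtain ⟨u, hu⟩ := L.exists_seq_tendsto
  have bound (x : X) : ∃ b, ∀ n, (u n).1 = x → (u n).2 < b := by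
    obtain ⟨N, hN⟩ := eventually_atTop.1 (hu.eventually (h x))
    obtain ⟨b, hb⟩ := ((Set.finite_Iio N).image fun n => (u n).2).bddAbove
    refine ⟨b + 1, fun n hn => Nat.lt_succ_of_le (hb ⟨n, ?_, rfl⟩)⟩
    by_contra hnN
    exact hN n (not_lt.1 hnN) hn
  choose b hb using bound
  have hmem : {p : X × ℕ | b p.1 ≤ p.2} ∈ fanFilter X :=
    mem_fanFilter.2 fun x => eventually_ge_atTop (b x)
  obtain ⟨n, hn⟩ := (hu.eventually (hL hmem)).exists
  exact (hb _ n rfl).not_ge hn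

/-- The relation lifting each point outside `K` to its column in `X × ℕ`. -/
def columnRel {X : Type u} (K : Set X) : Set (X × (X × ℕ)) := {p | p.1 = p.2.1 ∧ p.1 ∉ K}

theorem mesh_fanFilter_imgSet_columnRel {X : Type u} {F : Filter X} {K : Set X} (hK : K ∉ F) :
    Mesh (fanFilter X) (imgSet (columnRel K) F) := by
  have hle : comap Prod.fst (F ⊓ 𝓟 Kᶜ) ≤ imgSet (columnRel K) F := by
    refine le_iInf₂ fun f hf => le_principal_iff.2
      ⟨f ∩ Kᶜ, inter_mem_inf hf (mem_principal_self _), ?_⟩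
    rintro p ⟨hpf, hpK⟩
    exact ⟨p.1, hpf, rfl, hpK⟩
  have hne : (F ⊓ 𝓟 Kᶜ).NeBot := by
    rwa [neBot_iff, Ne, inf_principal_eq_bot, compl_compl]
  refine NeBot.mono (inf_neBot_iff.2 ?_) (inf_le_inf_left (fanFilter X) hle)
  rintro S hS T ⟨g, hg, hgT⟩
  obtain ⟨x, hx⟩ := hne.nonempty_of_mem hg
  obtain ⟨k, hk⟩ := (mem_fanFilter.1 hS x).exists
  exact ⟨(x, k), hk, hgT hx⟩

theorem column_compl_mem_imgSet_columnRel {X : Type u} (F : Filter X) (x : X) :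
    {p : X × ℕ | p.1 ≠ x} ∈ imgSet (columnRel F.ker) F := by
  obtain ⟨f, hf, hx⟩ : ∃ f ∈ F, x ∈ f → x ∈ F.ker := by
    by_cases hx : x ∈ F.ker
    · exact ⟨univ, univ_mem, fun _ => hx⟩
    · rw [mem_ker] at hx
      push Not at hx
      obtain ⟨f, hf, hxf⟩ := hx
      exact ⟨f, hf, fun h => absurd h hxf⟩
  refine mem_of_superset (mem_iInf_of_mem f (mem_iInf_of_mem hf (mem_principal_self _))) ?_
  rintro p ⟨z, hzf, hzp, hzK⟩ rfl
  simp only at hzp hzK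
  subst hzp
  exact hzK (hx hzf)

/-- A filter belongs to `ker(F_1^{△△})` iff it is principal. -/
theorem stmt11 {X : Type u} (F : Filter X) :
    (∀ (Y : Type u) (A : Set (X × Y)), ∀ H : Filter Y, Frechet H → Triangle (imgSet A F) H)
      ↔ ∃ A : Set X, F = 𝓟 A := by
  constructor
  · intro h
    refine ⟨F.ker, ?_⟩
    by_contra hF
    have hK : F.ker ∉ F := fun hK =>
      hF (le_antisymm (le_principal_iff.2 hK) fun _ hf => mem_principal.2 fun _ hx => mem_ker.1 hx _ hf)
    obtain ⟨L, hne, hcg, hL⟩ := h (X × ℕ) (columnRel F.ker) (fanFilter X) (frechet_fanFilter X)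
      (mesh_fanFilter_imgSet_columnRel hK)
    obtain ⟨x, hx⟩ := exists_column_compl_notMem (hL.trans inf_le_right)
    exact hx (hL.trans inf_le_left (column_compl_mem_imgSet_columnRel F x))
  · rintro ⟨S, rfl⟩ Y A H hH
    rw [imgSet_principal]
    exact (hH _).symm
end

section
/- Let κ be an infinite cardinal and F a filter on a set X. Then F ∈ ker((F_1^{◊_κ})^{◊_κ}) if and only if for every family (G_i)_{i∈I} of κ-tight filters on X such that the infimum ⋀_{i∈I} G_i meshes with F, there exists J ⊆ I with |J| ≤ κ such that ⋀_{i∈J} G_i meshes with F. -/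
open Filter Set

universe u

/-- The `◊_κ` relation: `F ◊_κ H` iff whenever `H` meshes `F` there is a set of
cardinality at most `κ` meshing with `F ∨ H` (i.e. `F ⊓ H`). -/
def DiamondK {Z : Type u} (κ : Cardinal.{u}) (F H : Filter Z) : Prop :=
  Mesh H F → ∃ A : Set Z, Cardinal.mk A ≤ κ ∧ Mesh (𝓟 A) (F ⊓ H)

/-- `κ`-tight filters: `F ◊_κ A` for every subset `A`, i.e. `F ∈ F_1^{◊_κ}`. -/
def KTight {Z : Type u} (κ : Cardinal.{u}) (F : Filter Z) : Prop :=
  ∀ A : Set Z, DiamondK κ F (𝓟 A)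

theorem mesh_comm {Z : Type u} {F G : Filter Z} : Mesh F G ↔ Mesh G F := by
  rw [Mesh, Mesh, inf_comm]

theorem mesh_iff {Z : Type u} {F G : Filter Z} :
    Mesh F G ↔ ∀ s ∈ F, ∃ᶠ x in G, x ∈ s := by
  simp only [Mesh, Filter.inf_neBot_iff, Filter.frequently_iff]
  exact ⟨fun h s hs t ht => (h hs ht).imp fun x hx => ⟨hx.2, hx.1⟩,
    fun h s hs t ht => (h s hs ht).imp fun x hx => ⟨hx.2, hx.1⟩⟩

theorem Mesh.mono_left {Z : Type u} {F F' G : Filter Z} (h : Mesh F G) (hF : F ≤ F') :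
    Mesh F' G :=
  Filter.NeBot.mono h (inf_le_inf_right G hF)

theorem mesh_principal_inf {Z : Type u} {A : Set Z} {F H : Filter Z} :
    Mesh (𝓟 A) (F ⊓ H) ↔ Mesh (H ⊓ 𝓟 A) F := by
  rw [Mesh, Mesh, inf_comm, inf_assoc, inf_comm]

theorem kTight_iff {Z : Type u} {κ : Cardinal.{u}} {F : Filter Z} :
    KTight κ F ↔ ∀ S : Set Z, (∃ᶠ x in F, x ∈ S) →
      ∃ B : Set Z, Cardinal.mk B ≤ κ ∧ ∃ᶠ x in F, x ∈ B ∧ x ∈ S := by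
  have h₁ (S : Set Z) : Mesh (𝓟 S) F ↔ ∃ᶠ x in F, x ∈ S := by
    rw [Mesh, inf_comm, Filter.frequently_mem_iff_neBot]
  have h₂ (S B : Set Z) : Mesh (𝓟 B) (F ⊓ 𝓟 S) ↔ ∃ᶠ x in F, x ∈ B ∧ x ∈ S := by
    rw [mesh_principal_inf, Filter.inf_principal, mesh_comm, Mesh,
      ← Filter.frequently_mem_iff_neBot]
    simp only [mem_inter_iff, and_comm]
  simp only [KTight, DiamondK, h₁, h₂]

theorem mem_imgSet {X Y : Type u} {A : Set (X × Y)} {F : Filter X} {D : Set Y} :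
    D ∈ imgSet A F ↔ {x | ∀ y, (x, y) ∈ A → y ∈ D} ∈ F := by
  have h : imgSet A F = F.lift' fun f => {y | ∃ x ∈ f, (x, y) ∈ A} := rfl
  have hmono : Monotone fun f : Set X => {y | ∃ x ∈ f, (x, y) ∈ A} :=
    fun s t hst y ⟨x, hx, hxy⟩ => ⟨x, hst hx, hxy⟩
  rw [h, Filter.mem_lift'_sets hmono]
  exact ⟨fun ⟨t, ht, h⟩ => mem_of_superset ht fun x hx y hxy => h ⟨x, hx, hxy⟩,
    fun h => ⟨_, h, fun y ⟨x, hx, hxy⟩ => hx y hxy⟩⟩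

theorem frequently_imgSet {X Y : Type u} {A : Set (X × Y)} {F : Filter X} {p : Y → Prop} :
    (∃ᶠ y in imgSet A F, p y) ↔ ∃ᶠ x in F, ∃ y, (x, y) ∈ A ∧ p y := by
  rw [Filter.Frequently, Filter.Frequently, not_iff_not]
  simp only [not_exists, not_and]
  exact mem_imgSet

theorem imgSet_mono {X Y : Type u} {A : Set (X × Y)} {F G : Filter X} (h : F ≤ G) :
    imgSet A F ≤ imgSet A G :=
  fun _ hD => mem_imgSet.2 (h (mem_imgSet.1 hD))

theorem imgSet_iSup {X Y I : Type u} {A : Set (X × Y)} {F : I → Filter X} :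
    imgSet A (⨆ i, F i) = ⨆ i, imgSet A (F i) := by
  ext D
  simp only [mem_imgSet, Filter.mem_iSup]

theorem mesh_imgSet {X Y : Type u} {A : Set (X × Y)} {F : Filter X} {H : Filter Y} :
    Mesh (imgSet (Prod.swap ⁻¹' A) H) F ↔ Mesh H (imgSet A F) := by
  rw [mesh_comm, mesh_iff, mesh_iff]
  simp only [frequently_imgSet]
  simp only [Filter.frequently_iff]
  constructor
  · intro h s hs t ht
    obtain ⟨y, hys, x, hxy, hxt⟩ := h t ht hs
    exact ⟨x, hxt, y, hxy, hys⟩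
  · intro h s hs t ht
    obtain ⟨x, hxs, y, hxy, hyt⟩ := h t ht hs
    exact ⟨y, hyt, x, hxy, hxs⟩

theorem KTight.imgSet {X Y : Type u} {κ : Cardinal.{u}} {A : Set (X × Y)} {F : Filter X}
    (hF : KTight κ F) : KTight κ (imgSet A F) := by
  rw [kTight_iff] at hF ⊢
  intro S hS
  rw [frequently_imgSet] at hS
  obtain ⟨B, hB, hBS⟩ := hF {x | ∃ y, (x, y) ∈ A ∧ y ∈ S} hS
  obtain ⟨_, y, -⟩ := hS.exists
  have : Nonempty Y := ⟨y⟩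
  choose! g hg using fun x (hx : ∃ y, (x, y) ∈ A ∧ y ∈ S) => hx
  refine ⟨g '' B, Cardinal.mk_image_le.trans hB, frequently_imgSet.2 (hBS.mono ?_)⟩
  rintro x ⟨hxB, hx⟩
  exact ⟨g x, (hg x hx).1, mem_image_of_mem g hxB, (hg x hx).2⟩

theorem KTight.inf_principal {Z : Type u} {κ : Cardinal.{u}} {F : Filter Z} {B : Set Z}
    (hB : Cardinal.mk B ≤ κ) : KTight κ (F ⊓ 𝓟 B) := by
  refine kTight_iff.2 fun S hS => ⟨B, hB, ?_⟩
  simp only [Filter.frequently_inf_principal] at hS ⊢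
  exact hS.mono fun x hx => ⟨hx.1, hx⟩

theorem KTight.iSup {Z I : Type u} {κ : Cardinal.{u}} {F : I → Filter Z}
    (hF : ∀ i, KTight κ (F i)) : KTight κ (⨆ i, F i) := by
  refine kTight_iff.2 fun S hS => ?_
  simp only [Filter.frequently_iSup] at hS ⊢
  obtain ⟨i, hi⟩ := hS
  obtain ⟨B, hB, h⟩ := kTight_iff.1 (hF i) S hi
  exact ⟨B, hB, i, h⟩

theorem KTight.le_iSup_inf_principal {Z : Type u} {κ : Cardinal.{u}} {F : Filter Z}
    (hF : KTight κ F) : F ≤ ⨆ B : {B : Set Z // Cardinal.mk B ≤ κ}, F ⊓ 𝓟 B.1 := by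
  intro D hD
  by_contra hDF
  obtain ⟨B, hB, h⟩ := kTight_iff.1 hF Dᶜ fun h => hDF (by simpa using h)
  have := Filter.mem_inf_principal.1 (Filter.mem_iSup.1 hD ⟨B, hB⟩)
  exact h (mem_of_superset this fun x hx hx' => hx'.2 (hx hx'.1))

/-- `F ∈ ker((F_1^{◊_κ})^{◊_κ})` iff every family of `κ`-tight filters whose infimum
(the paper's `⋀`, which is Mathlib's `⨆`) meshes `F` has a subfamily of size at most `κ`
whose infimum still meshes `F`. -/
theorem stmt12 {X : Type u} (κ : Cardinal.{u}) (hκ : Cardinal.aleph0 ≤ κ) (F : Filter X) :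
    (∀ (Y : Type u) (A : Set (X × Y)), ∀ H : Filter Y, KTight κ H →
        DiamondK κ (imgSet A F) H)
      ↔ ∀ (I : Type u) (G : I → Filter X), (∀ i, KTight κ (G i)) →
          Mesh (⨆ i, G i) F →
          ∃ J : Set I, Cardinal.mk J ≤ κ ∧ Mesh (⨆ i ∈ J, G i) F := by
  constructor
  · intro h I G hG hGF
    have hmap (i : I) : KTight κ (imgSet {p : X × (X × I) | p.2 = (p.1, i)} (G i)) :=
      (hG i).imgSet
    obtain ⟨B, hB, hm⟩ := h (X × I) {p | p.2.1 = p.1} _ (KTight.iSup hmap) <| by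
      refine mesh_iff.2 fun s hs => frequently_imgSet.2 ?_
      simp only [Filter.mem_iSup, mem_imgSet] at hs
      have hs' : {x | ∃ i, (x, i) ∈ s} ∈ ⨆ i, G i := Filter.mem_iSup.2 fun i =>
        mem_of_superset (hs i) fun x hx => ⟨i, hx (x, i) rfl⟩
      exact (mesh_iff.1 hGF _ hs').mono fun x ⟨i, hi⟩ => ⟨(x, i), rfl, hi⟩
    refine ⟨Prod.snd '' B, Cardinal.mk_image_le.trans hB, mesh_iff.2 fun s hs => ?_⟩
    have hs' : {p : X × I | p.2 ∈ Prod.snd '' B → p.1 ∈ s} ∈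
        ⨆ i, imgSet {p : X × (X × I) | p.2 = (p.1, i)} (G i) := by
      simp only [Filter.mem_iSup, mem_imgSet] at hs ⊢
      intro i
      by_cases hi : i ∈ Prod.snd '' B
      · filter_upwards [hs i hi]
        intro x hx p hp _
        obtain rfl : p = (x, i) := hp
        exact hx
      · refine Filter.univ_mem' ?_
        intro x p hp h
        obtain rfl : p = (x, i) := hp
        exact (hi h).elim
    have := mesh_iff.1 (mesh_principal_inf.1 hm) _
      (Filter.inter_mem_inf hs' (Filter.mem_principal_self B))
    refine (frequently_imgSet.1 this).mono ?_
    rintro x ⟨p, hpx, hp, hpB⟩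
    obtain rfl : p.1 = x := hpx
    exact hp (mem_image_of_mem _ hpB)
  · intro h Y A H hH hm
    obtain ⟨J, hJ, hJF⟩ := h {B : Set Y // Cardinal.mk B ≤ κ}
      (fun B => imgSet (Prod.swap ⁻¹' A) (H ⊓ 𝓟 B.1))
      (fun B => (KTight.inf_principal B.2).imgSet) <| by
        rw [← imgSet_iSup]
        exact (mesh_imgSet.2 hm).mono_left (imgSet_mono hH.le_iSup_inf_principal)
    refine ⟨⋃ B : J, B.1.1, ?_, ?_⟩
    · refine (Cardinal.mk_iUnion_le _).trans ?_
      exact (mul_le_mul' hJ (ciSup_le' fun B => B.1.2)).trans (Cardinal.mul_eq_self hκ).le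
    · refine mesh_principal_inf.2 (mesh_imgSet.1 (hJF.mono_left ?_))
      refine iSup₂_le fun B hB => imgSet_mono (inf_le_inf_left H (Filter.principal_mono.2 ?_))
      exact subset_iUnion (fun B : J => B.1.1) ⟨B, hB⟩
end
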